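/- For a (v,b,r,k,λ,ε)-block design scheme (Q, \hat P_n) and any P ∈ Δ_v, the risk under the mean squared loss equals R_{v,n}(ℓ_2², P, Q, \hat P_n) = (1/n)·( (v−1)²(ke^ε + v − k)² / (k(v−k)(e^ε−1)²·v) + 1/v − Σ_{x=1}^v P_x² ), and the worst-case risk equals R*_{v,n}(ℓ_2², Q, \hat P_n) = (v−1)²(ke^ε + v − k)² / (k(v−k)(e^ε−1)²·n·v), attained when P is the uniform distribution. -/

import Mathlib

open Finset Real
open scoped Classical

noncomputable section

/-- The "row" of an incidence structure: outputs incident to input `x`. -/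
def Ix {v : ℕ} {Y : Type*} [Fintype Y] [DecidableEq Y]
    (I : Finset (Fin v × Y)) (x : Fin v) : Finset Y :=
  Finset.univ.filter (fun y => (x, y) ∈ I)

/-- The "column" of an incidence structure: inputs incident to output `y`. -/
def Iy {v : ℕ} {Y : Type*} [Fintype Y] [DecidableEq Y]
    (I : Finset (Fin v × Y)) (y : Y) : Finset (Fin v) :=
  Finset.univ.filter (fun x => (x, y) ∈ I)

/-- A `(v,b,r,lam)`-regular pairwise-balanced design (RPBD). -/
def IsRPBD {v : ℕ} {Y : Type*} [Fintype Y] [DecidableEq Y]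
    (I : Finset (Fin v × Y)) (b r lam : ℕ) : Prop :=
  0 < v ∧ Fintype.card Y = b ∧ lam < r ∧ r < b ∧
    (∀ x : Fin v, (Ix I x).card = r) ∧
    (∀ x x' : Fin v, x ≠ x' → (Ix I x ∩ Ix I x').card = lam)

/-- A `(v,b,r,k,lam)`-block design: an RPBD that is moreover `k`-uniform, with `0 < k < v`. -/
def IsBlockDesign {v : ℕ} {Y : Type*} [Fintype Y] [DecidableEq Y]
    (I : Finset (Fin v × Y)) (b r k lam : ℕ) : Prop :=
  IsRPBD I b r lam ∧ 0 < k ∧ k < v ∧ ∀ y : Y, (Iy I y).card = k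

/-- The (block design / RPBD) privacy mechanism: output `y` has probability `α e^ε` if
`(x,y) ∈ I` and `α` otherwise, where `α = 1/(r e^ε + b - r)`. -/
def mechQ {v : ℕ} {Y : Type*} [Fintype Y] [DecidableEq Y]
    (I : Finset (Fin v × Y)) (b r : ℕ) (ε : ℝ) (x : Fin v) (y : Y) : ℝ :=
  if (x, y) ∈ I then Real.exp ε / ((r : ℝ) * Real.exp ε + (b : ℝ) - (r : ℝ))
  else 1 / ((r : ℝ) * Real.exp ε + (b : ℝ) - (r : ℝ))

/-- The probability simplex `Δ_v` on `{1,…,v}`. -/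
def simplex (v : ℕ) : Set (Fin v → ℝ) :=
  {P | (∀ x, 0 ≤ P x) ∧ ∑ x, P x = 1}

/-- Marginal distribution of a single privatized output `Y` when `X ~ P`, `Y ~ Q(·|X)`. -/
def outDist {v : ℕ} {Y : Type*} [Fintype Y] (P : Fin v → ℝ) (Q : Fin v → Y → ℝ) (y : Y) : ℝ :=
  ∑ x, P x * Q x y

/-- Joint probability of the i.i.d. outputs `(Y_1,…,Y_n)`. -/
def jointW {v n : ℕ} {Y : Type*} [Fintype Y] (P : Fin v → ℝ) (Q : Fin v → Y → ℝ)
    (ys : Fin n → Y) : ℝ :=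
  ∏ i, outDist P Q (ys i)

/-- The count `N_x(Y_1,…,Y_n) = Σ_i 1(Y_i ∈ ℐ_x)`. -/
def Nx {v n : ℕ} {Y : Type*} [Fintype Y] [DecidableEq Y]
    (I : Finset (Fin v × Y)) (x : Fin v) (ys : Fin n → Y) : ℕ :=
  (Finset.univ.filter (fun i => ys i ∈ Ix I x)).card

/-- The canonical (unbiased) estimator of an RPBD scheme. -/
def canonEst {v n : ℕ} {Y : Type*} [Fintype Y] [DecidableEq Y]
    (I : Finset (Fin v × Y)) (b r lam : ℕ) (ε : ℝ) (x : Fin v) (ys : Fin n → Y) : ℝ :=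
  (1 / (((r : ℝ) - (lam : ℝ)) * (Real.exp ε - 1))) *
    ((Nx I x ys : ℝ) * ((r : ℝ) * Real.exp ε + (b : ℝ) - (r : ℝ)) / (n : ℝ)
      - ((lam : ℝ) * Real.exp ε + ((r : ℝ) - (lam : ℝ))))

/-- The squared `ℓ_2` loss. -/
def l2loss (v : ℕ) (p phat : Fin v → ℝ) : ℝ := ∑ x, (p x - phat x) ^ 2

/-- The risk `R_{v,n}(ℓ, P, Q, P̂_n) = E[ℓ(P, P̂_n(Y_1,…,Y_n))]`. -/
def risk {v : ℕ} {Y : Type*} [Fintype Y] (n : ℕ) (P : Fin v → ℝ) (Q : Fin v → Y → ℝ)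
    (L : (Fin v → ℝ) → (Fin v → ℝ) → ℝ) (est : Fin v → (Fin n → Y) → ℝ) : ℝ :=
  ∑ ys : Fin n → Y, jointW P Q ys * L P (fun x => est x ys)

/-- Marginal equivalence of two schemes: for every `P ∈ Δ_v` and coordinate `x`, the
estimators `P̂_{n,x}` and `P̂'_{n,x}` have the same distribution. -/
def MargEquiv {v : ℕ} {Y Y' : Type*} [Fintype Y] [Fintype Y'] (n : ℕ)
    (Q : Fin v → Y → ℝ) (est : Fin v → (Fin n → Y) → ℝ)
    (Q' : Fin v → Y' → ℝ) (est' : Fin v → (Fin n → Y') → ℝ) : Prop :=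
  ∀ P ∈ simplex v, ∀ x : Fin v, ∀ t : ℝ,
    (∑ ys : Fin n → Y, if est x ys = t then jointW P Q ys else 0)
      = ∑ ys : Fin n → Y', if est' x ys = t then jointW P Q' ys else 0

/-- The second moment of a sum of independent centred variables is additive. -/
theorem sum_prod_mul_sq_sum_of_centred {Y : Type*} [Fintype Y] (p f : Y → ℝ)
    (hp : ∑ y, p y = 1) (hf : ∑ y, p y * f y = 0) (n : ℕ) :
    ∑ ys : Fin n → Y, (∏ i, p (ys i)) * (∑ i, f (ys i)) ^ 2 = n * ∑ y, p y * f y ^ 2 := by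
  have mass : ∀ m : ℕ, ∑ ys : Fin m → Y, ∏ i, p (ys i) = 1 := fun m => by
    rw [← Fintype.piFinset_univ, ← Finset.prod_univ_sum]
    simp [hp]
  induction n with
  | zero => simp
  | succ m ih =>
    rw [← (Fin.consEquiv fun _ => Y).sum_comp, Fintype.sum_prod_type]
    have split : ∀ (y : Y) (ys : Fin m → Y),
        (∏ i, p (Fin.consEquiv (fun _ => Y) (y, ys) i)) *
            (∑ i, f (Fin.consEquiv (fun _ => Y) (y, ys) i)) ^ 2
          = p y * f y ^ 2 * ∏ i, p (ys i)
            + 2 * (p y * f y) * ((∏ i, p (ys i)) * ∑ i, f (ys i))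
            + p y * ((∏ i, p (ys i)) * (∑ i, f (ys i)) ^ 2) := fun y ys => by
      simp only [Fin.consEquiv_apply, Fin.prod_univ_succ, Fin.sum_univ_succ, Fin.cons_zero,
        Fin.cons_succ]
      ring
    simp only [split, Finset.sum_add_distrib, ← Finset.mul_sum, ← Finset.sum_mul, mass, ih, hf, hp]
    push_cast
    ring

/-- Double counting of the incidences: `b k = v r`. -/
theorem IsBlockDesign.card_mul_eq {v b r k lam : ℕ} {Y : Type*} [Fintype Y] [DecidableEq Y]
    {I : Finset (Fin v × Y)} (h : IsBlockDesign I b r k lam) : b * k = v * r := by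
  obtain ⟨⟨-, hb, -, -, hr, -⟩, -, -, hk⟩ := h
  have count := Finset.sum_card_bipartiteAbove_eq_sum_card_bipartiteBelow
    (s := (Finset.univ : Finset (Fin v))) (t := (Finset.univ : Finset Y)) (fun x y => (x, y) ∈ I)
  have rows : ∀ x, (Finset.univ.bipartiteAbove (fun x y => (x, y) ∈ I) x).card = r :=
    fun x => by rw [← hr x]; congr!
  have cols : ∀ y, (Finset.univ.bipartiteBelow (fun x y => (x, y) ∈ I) y).card = k :=
    fun y => by rw [← hk y]; congr!
  simp only [rows, cols, Finset.sum_const, Finset.card_univ, Fintype.card_fin, hb,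
    smul_eq_mul] at count
  exact count.symm

/-- Double counting of the pairs sharing a block: `r k = r + (v - 1) λ`. -/
theorem IsBlockDesign.mul_add_eq {v b r k lam : ℕ} {Y : Type*} [Fintype Y] [DecidableEq Y]
    {I : Finset (Fin v × Y)} (h : IsBlockDesign I b r k lam) : r * k + lam = r + v * lam := by
  obtain ⟨⟨hv, -, -, -, hr, hl⟩, -, -, hk⟩ := h
  let x₀ : Fin v := ⟨0, hv⟩
  have count := Finset.sum_card_bipartiteAbove_eq_sum_card_bipartiteBelow
    (s := (Finset.univ : Finset (Fin v))) (t := Ix I x₀) (fun x y => (x, y) ∈ I)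
  have rows : ∀ x, ((Ix I x₀).bipartiteAbove (fun x y => (x, y) ∈ I) x).card
      = if x = x₀ then r else lam := fun x => by
    have inter : (Ix I x₀).bipartiteAbove (fun x y => (x, y) ∈ I) x = Ix I x₀ ∩ Ix I x := by
      ext y; simp [Finset.bipartiteAbove, Ix]
    rw [inter]
    split_ifs with hx
    · rw [hx, Finset.inter_self, hr]
    · exact hl _ _ (Ne.symm hx)
  have cols : ∀ y, (Finset.univ.bipartiteBelow (fun x y => (x, y) ∈ I) y).card = k :=
    fun y => by rw [← hk y]; congr!
  simp only [rows, cols, Finset.sum_const, hr, smul_eq_mul] at count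
  rw [← Finset.add_sum_erase _ _ (Finset.mem_univ x₀), Finset.sum_congr rfl
    (fun x hx => if_neg (Finset.ne_of_mem_erase hx))] at count
  simp only [if_true, Finset.sum_const, Finset.card_erase_of_mem (Finset.mem_univ x₀),
    Finset.card_univ, Fintype.card_fin, smul_eq_mul] at count
  obtain ⟨w, rfl⟩ : ∃ w, v = w + 1 := ⟨v - 1, by omega⟩
  simp only [Nat.add_sub_cancel] at count
  linarith

/-- The mechanism gives a set of outputs `S` mass proportional to
`|I_x ∩ S| e^ε + |S| - |I_x ∩ S|`. -/
theorem sum_mechQ {v : ℕ} {Y : Type*} [Fintype Y] [DecidableEq Y] (I : Finset (Fin v × Y))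
    (b r : ℕ) (ε : ℝ) (x : Fin v) (S : Finset Y) :
    ∑ y ∈ S, mechQ I b r ε x y
      = (((Ix I x ∩ S).card : ℝ) * Real.exp ε + S.card - (Ix I x ∩ S).card)
        / ((r : ℝ) * Real.exp ε + b - r) := by
  have weight : ∀ y, mechQ I b r ε x y
      = (1 + (if y ∈ Ix I x then 1 else 0) * (Real.exp ε - 1))
        / ((r : ℝ) * Real.exp ε + b - r) := fun y => by
    unfold mechQ
    by_cases hy : (x, y) ∈ I <;> simp [Ix, hy]
  simp only [weight, ← Finset.sum_div, Finset.sum_add_distrib, ← Finset.sum_mul,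
    Finset.sum_const, Finset.sum_ite_mem, nsmul_eq_mul, mul_one, Finset.inter_comm S]
  ring

section RPBD

variable {v b r lam : ℕ} {Y : Type*} [Fintype Y] [DecidableEq Y] {I : Finset (Fin v × Y)}

theorem IsRPBD.normalizer_pos (h : IsRPBD I b r lam) (ε : ℝ) :
    0 < (r : ℝ) * Real.exp ε + b - r := by
  have hrb : (r : ℝ) < b := by exact_mod_cast h.2.2.2.1
  have := mul_nonneg (Nat.cast_nonneg (α := ℝ) r) (Real.exp_pos ε).le
  linarith

theorem IsRPBD.sum_outDist (h : IsRPBD I b r lam) (ε : ℝ) {P : Fin v → ℝ}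
    (hP : ∑ x, P x = 1) : ∑ y, outDist P (mechQ I b r ε) y = 1 := by
  have row : ∀ x, ∑ y, mechQ I b r ε x y = 1 := fun x => by
    rw [sum_mechQ, Finset.inter_univ, h.2.2.2.2.1, Finset.card_univ, h.2.1,
      div_self (h.normalizer_pos ε).ne']
  unfold outDist
  rw [Finset.sum_comm]
  simp only [← Finset.mul_sum, row, mul_one, hP]

/-- The probability that an output is incident to `x` is affine in `P x`. -/
theorem IsRPBD.sum_outDist_Ix (h : IsRPBD I b r lam) (ε : ℝ) {P : Fin v → ℝ}
    (hP : ∑ x, P x = 1) (x : Fin v) :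
    ∑ y ∈ Ix I x, outDist P (mechQ I b r ε) y
      = (lam * Real.exp ε + (r - lam) + P x * ((r - lam) * (Real.exp ε - 1)))
        / ((r : ℝ) * Real.exp ε + b - r) := by
  have row : ∀ x', ∑ y ∈ Ix I x, mechQ I b r ε x' y
      = (lam * Real.exp ε + (r - lam)
          + if x' = x then ((r : ℝ) - lam) * (Real.exp ε - 1) else 0)
        / ((r : ℝ) * Real.exp ε + b - r) := fun x' => by
    rw [sum_mechQ, h.2.2.2.2.1]
    split_ifs with hx
    · rw [hx, Finset.inter_self, h.2.2.2.2.1]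
      ring
    · rw [h.2.2.2.2.2 _ _ hx]
      ring
  unfold outDist
  rw [Finset.sum_comm]
  simp only [← Finset.mul_sum, row, mul_div_assoc', ← Finset.sum_div, mul_add, mul_ite, mul_zero,
    Finset.sum_add_distrib, ← Finset.sum_mul, hP, one_mul, Finset.sum_ite_eq', Finset.mem_univ,
    if_true]

/-- The mean squared error of one coordinate of the canonical estimator. -/
theorem IsRPBD.coord_mse (h : IsRPBD I b r lam) {n : ℕ} (hn : 0 < n) {ε : ℝ} (hε : 0 < ε)
    {P : Fin v → ℝ} (hP : ∑ x, P x = 1) (x : Fin v) :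
    ∑ ys : Fin n → Y, jointW P (mechQ I b r ε) ys * (P x - canonEst I b r lam ε x ys) ^ 2
      = (lam * Real.exp ε + (r - lam) + P x * ((r - lam) * (Real.exp ε - 1)))
        * ((r : ℝ) * Real.exp ε + b - r
            - (lam * Real.exp ε + (r - lam) + P x * ((r - lam) * (Real.exp ε - 1))))
        / (n * ((r - lam) * (Real.exp ε - 1)) ^ 2) := by
  have hD := h.normalizer_pos ε
  have hq := h.sum_outDist_Ix ε hP x
  have hp := h.sum_outDist ε hP
  have hc : ((r : ℝ) - lam) * (Real.exp ε - 1) ≠ 0 := by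
    have hlr : (lam : ℝ) < r := by exact_mod_cast h.2.2.1
    have := Real.one_lt_exp_iff.2 hε
    exact mul_ne_zero (by linarith) (by linarith)
  have hn' : (n : ℝ) ≠ 0 := by exact_mod_cast hn.ne'
  set D : ℝ := (r : ℝ) * Real.exp ε + b - r with hDdef
  set c : ℝ := ((r : ℝ) - lam) * (Real.exp ε - 1) with hcdef
  set A : ℝ := lam * Real.exp ε + (r - lam) with hA
  set p : Y → ℝ := outDist P (mechQ I b r ε) with hpdef
  set q : ℝ := (A + P x * c) / D with hqdef
  let f : Y → ℝ := fun y => (if y ∈ Ix I x then 1 else 0) - q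
  have ind : ∑ y, p y * (if y ∈ Ix I x then 1 else 0) = q := by
    simp [← hq]
  have hf : ∑ y, p y * f y = 0 := by
    simp only [f, mul_sub, Finset.sum_sub_distrib, ← Finset.sum_mul, hp, ind]
    ring
  have hf2 : ∑ y, p y * f y ^ 2 = q * (1 - q) := by
    have expand : ∀ y, p y * f y ^ 2
        = (1 - 2 * q) * (p y * (if y ∈ Ix I x then 1 else 0)) + q ^ 2 * p y := fun y => by
      simp only [f]
      split_ifs <;> ring
    simp only [expand, Finset.sum_add_distrib, ← Finset.mul_sum, hp, ind]
    ring
  have err : ∀ ys : Fin n → Y, (P x - canonEst I b r lam ε x ys) ^ 2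
      = (D / (n * c)) ^ 2 * (∑ i, f (ys i)) ^ 2 := fun ys => by
    have hN : ∑ i, f (ys i) = Nx I x ys - n * q := by
      simp [f, Nx, Finset.sum_sub_distrib]
    rw [hN, canonEst, ← hDdef, ← hcdef, ← hA, hqdef]
    field_simp
    ring
  have key := sum_prod_mul_sq_sum_of_centred p f hp hf n
  simp only [err, mul_left_comm (jointW _ _ _), ← Finset.mul_sum]
  simp only [jointW, ← hpdef, key, hf2, hqdef]
  field_simp

end RPBD

/-- The exact mean squared risk of a block design scheme. -/
theorem IsBlockDesign.risk_l2loss {v n b r k lam : ℕ} (hn : 0 < n) {Y : Type*}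
    [Fintype Y] [DecidableEq Y] {I : Finset (Fin v × Y)}
    (h : IsBlockDesign I b r k lam) {ε : ℝ} (hε : 0 < ε) {P : Fin v → ℝ} (hP : ∑ x, P x = 1) :
    risk n P (mechQ I b r ε) (l2loss v) (canonEst I b r lam ε)
      = (1 / (n : ℝ)) *
          (((v : ℝ) - 1) ^ 2 * ((k : ℝ) * Real.exp ε + (v : ℝ) - (k : ℝ)) ^ 2
            / ((k : ℝ) * ((v : ℝ) - (k : ℝ)) * (Real.exp ε - 1) ^ 2 * (v : ℝ))
          + 1 / (v : ℝ) - ∑ x, P x ^ 2) := by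
  have hbk : (b : ℝ) * k = v * r := by exact_mod_cast h.card_mul_eq
  have hrk : (r : ℝ) * k + lam = r + v * lam := by exact_mod_cast h.mul_add_eq
  have hk : (0 : ℝ) < k := by exact_mod_cast h.2.1
  have hk1 : (1 : ℝ) ≤ k := by exact_mod_cast h.2.1
  have hkv : (k : ℝ) < v := by exact_mod_cast h.2.2.1
  have hr : (0 : ℝ) < r := by exact_mod_cast (Nat.zero_le _).trans_lt h.1.2.2.1
  have hE := Real.one_lt_exp_iff.2 hε
  simp only [risk, l2loss, Finset.mul_sum]
  rw [Finset.sum_comm]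
  simp only [h.1.coord_mse hn hε hP]
  rw [← Finset.sum_div]
  have expand : ∀ A c D : ℝ, ∑ x, (A + P x * c) * (D - (A + P x * c))
      = v * (A * (D - A)) + c * (D - 2 * A) - c ^ 2 * ∑ x, P x ^ 2 := fun A c D => by
    have pt : ∀ x, (A + P x * c) * (D - (A + P x * c))
        = A * (D - A) + P x * (c * (D - 2 * A)) - c ^ 2 * P x ^ 2 := fun x => by ring
    simp only [pt, Finset.sum_sub_distrib, Finset.sum_add_distrib, ← Finset.sum_mul,
      ← Finset.mul_sum, hP, Finset.sum_const, Finset.card_univ, Fintype.card_fin, nsmul_eq_mul]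
    ring
  rw [expand]
  have hv1 : (v : ℝ) - 1 ≠ 0 := by linarith
  have hvk : (v : ℝ) - k ≠ 0 := by linarith
  have hv : (v : ℝ) ≠ 0 := by linarith
  have hE1 : Real.exp ε - 1 ≠ 0 := by linarith
  have hb : (b : ℝ) = v * r / k := by rw [← hbk]; field_simp
  have hl : (lam : ℝ) = r * (k - 1) / (v - 1) := by field_simp; linarith
  have hrl : (r : ℝ) - lam = r * (v - k) / (v - 1) := by rw [hl]; field_simp; ring
  rw [hrl, hb, hl]
  field_simp
  ring

/-- Exact and worst-case `ℓ_2²` risk of a `(v,b,r,k,lam,ε)`-block design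
scheme; the worst case is attained at the uniform distribution. -/
theorem block_design_l2_risk {v n b r k lam : ℕ} (hn : 0 < n) {Y : Type*}
    [Fintype Y] [DecidableEq Y] (I : Finset (Fin v × Y))
    (h : IsBlockDesign I b r k lam) (ε : ℝ) (hε : 0 < ε) :
    (∀ P ∈ simplex v,
      risk n P (mechQ I b r ε) (l2loss v) (canonEst I b r lam ε)
        = (1 / (n : ℝ)) *
            (((v : ℝ) - 1) ^ 2 * ((k : ℝ) * Real.exp ε + (v : ℝ) - (k : ℝ)) ^ 2
              / ((k : ℝ) * ((v : ℝ) - (k : ℝ)) * (Real.exp ε - 1) ^ 2 * (v : ℝ))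
            + 1 / (v : ℝ) - ∑ x, P x ^ 2))
    ∧ (∀ P ∈ simplex v,
        risk n P (mechQ I b r ε) (l2loss v) (canonEst I b r lam ε)
          ≤ ((v : ℝ) - 1) ^ 2 * ((k : ℝ) * Real.exp ε + (v : ℝ) - (k : ℝ)) ^ 2
              / ((k : ℝ) * ((v : ℝ) - (k : ℝ)) * (Real.exp ε - 1) ^ 2 * (n : ℝ) * (v : ℝ)))
    ∧ risk n (fun _ => 1 / (v : ℝ)) (mechQ I b r ε) (l2loss v) (canonEst I b r lam ε)
        = ((v : ℝ) - 1) ^ 2 * ((k : ℝ) * Real.exp ε + (v : ℝ) - (k : ℝ)) ^ 2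
            / ((k : ℝ) * ((v : ℝ) - (k : ℝ)) * (Real.exp ε - 1) ^ 2 * (n : ℝ) * (v : ℝ)) := by
  have hv : (0 : ℝ) < v := by exact_mod_cast h.1.1
  refine ⟨fun P hP => h.risk_l2loss hn hε hP.2, fun P hP => ?_, ?_⟩
  · rw [h.risk_l2loss hn hε hP.2]
    have hsq : 1 / (v : ℝ) ≤ ∑ x, P x ^ 2 := by
      have := sq_sum_le_card_mul_sum_sq (s := Finset.univ) (f := P)
      rw [hP.2, Finset.card_univ, Fintype.card_fin] at this
      rw [div_le_iff₀ hv]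
      linarith
    calc _ ≤ (1 / (n : ℝ)) * (((v : ℝ) - 1) ^ 2 * ((k : ℝ) * Real.exp ε + (v : ℝ) - (k : ℝ)) ^ 2
            / ((k : ℝ) * ((v : ℝ) - (k : ℝ)) * (Real.exp ε - 1) ^ 2 * (v : ℝ))) := by
          gcongr
          linarith
      _ = _ := by
          rw [div_mul_div_comm, one_mul]
          congr 1
          ring
  · have hP : ∑ _x : Fin v, 1 / (v : ℝ) = 1 := by simp [hv.ne']
    have hsq : ∑ _x : Fin v, (1 / (v : ℝ)) ^ 2 = 1 / (v : ℝ) := by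
      simp only [Finset.sum_const, Finset.card_univ, Fintype.card_fin, nsmul_eq_mul]
      field_simp
    rw [h.risk_l2loss hn hε hP, hsq, add_sub_cancel_right, div_mul_div_comm, one_mul]
    congr 1
    ring

end
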